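/- arXiv:1908.03865 — 2 statements merged into one kernel-verified Lean document; each statement's English description precedes it below -/
import Mathlib

section
/- Let A, B, C, D ∈ ℝ³ be affinely independent and let τ = ⟨A,B,C,D⟩ be their convex hull (a tetrahedron). If P, Q ∈ ℝ³ are points with P ∉ τ and Q ∉ τ but [P,Q] ∩ τ ≠ ∅, then the closed segment [P,Q] intersects at least two of the four closed triangular faces ⟨A,B,C⟩, ⟨A,B,D⟩, ⟨A,C,D⟩, ⟨B,C,D⟩ of τ. -/
open scoped Matrix

noncomputable section

/-- A point of 3-space. -/
abbrev Pt : Type := Fin 3 → ℝ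

/-- A (non-degenerate) triangle in 3-space, given by three affinely independent vertices. -/
structure Tri where
  A : Pt
  B : Pt
  C : Pt
  indep : AffineIndependent ℝ ![A, B, C]

namespace Tri

/-- The set of vertices of a triangle. -/
def vertexSet (T : Tri) : Set Pt := {T.A, T.B, T.C}

/-- The outline `∂T` of a triangle: the union of the three closed edges. -/
def outline (T : Tri) : Set Pt :=
  segment ℝ T.A T.B ∪ segment ℝ T.B T.C ∪ segment ℝ T.C T.A

/-- The convex hull `⟨T⟩` of a triangle. -/
def hull (T : Tri) : Set Pt := convexHull ℝ {T.A, T.B, T.C}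

end Tri

/-- A family of triangles is a linking if the outlines are pairwise disjoint. -/
def IsLinking {ι : Type*} (T : ι → Tri) : Prop :=
  ∀ i j, i ≠ j → Disjoint (T i).outline (T j).outline

/-- An elementary move replaces one triangle `ABC` of the family by `ABC'`, where `C'` is a
point not on the line `AB` such that `(⟨A,C,C'⟩ ∪ ⟨B,C,C'⟩) ∩ ∂XYZ = ∅` for every other
triangle `XYZ` of the family. -/
def ElemMove {ι : Type*} (T T' : ι → Tri) : Prop :=
  ∃ (i : ι) (A B C C' : Pt),
    (T i).vertexSet = {A, B, C} ∧
    (T' i).vertexSet = {A, B, C'} ∧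
    C' ∉ affineSpan ℝ ({A, B} : Set Pt) ∧
    ∀ j, j ≠ i →
      (convexHull ℝ ({A, C, C'} : Set Pt) ∪ convexHull ℝ ({B, C, C'} : Set Pt))
          ∩ (T j).outline = ∅ ∧
      T' j = T j

/-- Two families of triangles are combinatorially isotopic if one can be obtained from the
other by a finite sequence of elementary moves. -/
def CombIsotopic {ι : Type*} (T T' : ι → Tri) : Prop :=
  Relation.ReflTransGen ElemMove T T'

theorem aux_exit (p x : Fin 4 → ℝ) (hx : ∀ k, 0 ≤ x k) (hp : ∃ k, p k < 0) :
    ∃ (s : ℝ) (i : Fin 4), 0 ≤ s ∧ s ≤ 1 ∧ p i < 0 ∧ (1 - s) * p i + s * x i = 0 ∧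
      ∀ k, 0 ≤ (1 - s) * p k + s * x k := by
  classical
  obtain ⟨k0, hk0⟩ := hp
  obtain ⟨i, hi, hmax⟩ := Finset.exists_max_image (Finset.univ.filter fun k => p k < 0)
    (fun k => -p k / (x k - p k)) ⟨k0, by simp [hk0]⟩
  have hi' : p i < 0 := by simpa using hi
  have hd : 0 < x i - p i := by linarith [hx i]
  have hs0 : 0 ≤ -p i / (x i - p i) := by apply div_nonneg <;> linarith
  have hs1 : -p i / (x i - p i) ≤ 1 := by rw [div_le_one hd]; linarith [hx i]
  refine ⟨-p i / (x i - p i), i, hs0, hs1, hi', ?_, ?_⟩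
  · field_simp
    ring
  · intro k
    by_cases hk : p k < 0
    · have h1 := hmax k (by simp [hk])
      have hdk : 0 < x k - p k := by linarith [hx k]
      rw [div_le_iff₀ hdk] at h1
      linarith
    · have h2 := mul_nonneg (sub_nonneg.2 hs1) (not_lt.1 hk)
      have h3 := mul_nonneg hs0 (hx k)
      linarith

theorem aux_tri (A B C y : Pt) (a b c : ℝ) (ha : 0 ≤ a) (hb : 0 ≤ b) (hc : 0 ≤ c)
    (h1 : a + b + c = 1) (hy : y = a • A + b • B + c • C) :
    y ∈ convexHull ℝ ({A, B, C} : Set Pt) := by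
  have := (convex_convexHull ℝ ({A, B, C} : Set Pt)).sum_mem (t := Finset.univ)
    (w := ![a, b, c]) (z := ![A, B, C])
    (by intro i _; fin_cases i <;> simpa) (by simpa [Fin.sum_univ_three] using h1)
    (by intro i _; apply subset_convexHull; fin_cases i <;> simp)
  simpa [Fin.sum_univ_three, hy] using this

theorem aux_face (A B C D y : Pt) (w : Fin 4 → ℝ) (hw : ∀ k, 0 ≤ w k)
    (h1 : w 0 + w 1 + w 2 + w 3 = 1) (hy : y = w 0 • A + w 1 • B + w 2 • C + w 3 • D)
    (i : Fin 4) (hi : w i = 0) :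
    y ∈ ![convexHull ℝ ({A, B, C} : Set Pt), convexHull ℝ ({A, B, D} : Set Pt),
          convexHull ℝ ({A, C, D} : Set Pt), convexHull ℝ ({B, C, D} : Set Pt)] (Fin.rev i) := by
  fin_cases i
  · have hi : w 0 = 0 := hi
    exact aux_tri B C D y (w 1) (w 2) (w 3) (hw _) (hw _) (hw _) (by linarith) (by simp [hy, hi])
  · have hi : w 1 = 0 := hi
    exact aux_tri A C D y (w 0) (w 2) (w 3) (hw _) (hw _) (hw _) (by linarith) (by simp [hy, hi])
  · have hi : w 2 = 0 := hi
    exact aux_tri A B D y (w 0) (w 1) (w 3) (hw _) (hw _) (hw _) (by linarith) (by simp [hy, hi])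
  · have hi : w 3 = 0 := hi
    exact aux_tri A B C y (w 0) (w 1) (w 2) (hw _) (hw _) (hw _) (by linarith) (by simp [hy, hi])

/-- If a segment with both endpoints outside a tetrahedron meets the tetrahedron, then it
meets at least two of the four closed triangular faces. -/
theorem stmt16 (A B C D : Pt) (h : AffineIndependent ℝ ![A, B, C, D])
    (P Q : Pt)
    (hP : P ∉ convexHull ℝ ({A, B, C, D} : Set Pt))
    (hQ : Q ∉ convexHull ℝ ({A, B, C, D} : Set Pt))
    (hseg : (segment ℝ P Q ∩ convexHull ℝ ({A, B, C, D} : Set Pt)).Nonempty) :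
    ∃ i j : Fin 4, i ≠ j ∧
      (segment ℝ P Q ∩
        ![convexHull ℝ ({A, B, C} : Set Pt), convexHull ℝ ({A, B, D} : Set Pt),
          convexHull ℝ ({A, C, D} : Set Pt), convexHull ℝ ({B, C, D} : Set Pt)] i).Nonempty ∧
      (segment ℝ P Q ∩
        ![convexHull ℝ ({A, B, C} : Set Pt), convexHull ℝ ({A, B, D} : Set Pt),
          convexHull ℝ ({A, C, D} : Set Pt), convexHull ℝ ({B, C, D} : Set Pt)] j).Nonempty := by
  have htop : affineSpan ℝ (Set.range ![A, B, C, D]) = ⊤ := by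
    rw [h.affineSpan_eq_top_iff_card_eq_finrank_add_one]
    simp
  let b : AffineBasis (Fin 4) ℝ Pt := ⟨![A, B, C, D], h, htop⟩
  have hb : (b : Fin 4 → Pt) = ![A, B, C, D] := rfl
  have hr : Set.range b = ({A, B, C, D} : Set Pt) := by
    rw [hb]
    ext z
    simp [eq_comm]
    tauto
  have hull : convexHull ℝ ({A, B, C, D} : Set Pt) = {x | ∀ i, 0 ≤ b.coord i x} := by
    rw [← hr, b.convexHull_eq_nonneg_coord]
  rw [hull] at hP hQ hseg
  obtain ⟨x, hxs, hx⟩ := hseg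
  simp only [Set.mem_ofPred_eq, not_forall, not_le] at hP hQ hx
  have hcoord : ∀ (U V : Pt) (s : ℝ) (k : Fin 4),
      b.coord k (AffineMap.lineMap U V s) = (1 - s) * b.coord k U + s * b.coord k V := by
    intro U V s k
    rw [AffineMap.apply_lineMap, AffineMap.lineMap_apply_module]
    simp
  have key : ∀ R : Pt, R ∈ segment ℝ P Q → (∃ k, b.coord k R < 0) →
      ∃ i, b.coord i R < 0 ∧ (segment ℝ P Q ∩
        ![convexHull ℝ ({A, B, C} : Set Pt), convexHull ℝ ({A, B, D} : Set Pt),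
          convexHull ℝ ({A, C, D} : Set Pt), convexHull ℝ ({B, C, D} : Set Pt)]
            (Fin.rev i)).Nonempty := by
    intro R hR hRn
    obtain ⟨s, i, hs0, hs1, hi, hz, hnn⟩ :=
      aux_exit (fun k => b.coord k R) (fun k => b.coord k x) hx hRn
    refine ⟨i, hi, AffineMap.lineMap R x s, ?_, ?_⟩
    · apply (convex_segment P Q).segment_subset hR hxs
      rw [segment_eq_image_lineMap]
      exact ⟨s, ⟨hs0, hs1⟩, rfl⟩
    · refine aux_face A B C D _ (fun k => b.coord k (AffineMap.lineMap R x s)) ?_ ?_ ?_ i ?_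
      · intro k
        simp only [hcoord]
        exact hnn k
      · have := b.sum_coord_apply_eq_one (AffineMap.lineMap R x s)
        rwa [Fin.sum_univ_four] at this
      · have := b.linear_combination_coord_eq_self (AffineMap.lineMap R x s)
        rw [Fin.sum_univ_four, hb] at this
        exact this.symm
      · simp only [hcoord]
        exact hz
  obtain ⟨i, hi, hi'⟩ := key P (left_mem_segment ℝ P Q) hP
  obtain ⟨j, hj, hj'⟩ := key Q (right_mem_segment ℝ P Q) hQ
  refine ⟨Fin.rev i, Fin.rev j, ?_, hi', hj'⟩
  intro hij
  have hij := Fin.rev_injective hij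
  subst hij
  rw [segment_eq_image_lineMap] at hxs
  obtain ⟨t, ⟨ht0, ht1⟩, rfl⟩ := hxs
  have := hx i
  rw [hcoord] at this
  rcases ht0.eq_or_lt with h0 | h0
  · subst h0
    linarith
  · have e1 := mul_neg_of_pos_of_neg h0 hj
    have e2 := mul_nonpos_of_nonneg_of_nonpos (sub_nonneg.2 ht1) hi.le
    linarith
end
end

section
/- Let Δ0 = ABC, Δ1, Δ2 be triangles in ℝ³ with pairwise disjoint outlines such that ⟨Δ0⟩ ∩ ⟨Δ1⟩ ∩ ⟨Δ2⟩ ≠ ∅ and for each j ∈ {0,1,2} the set ∂Δj ∩ ⟨Δ_{(j+1) mod 3}⟩ consists of exactly two points. Let C' be a point not on the line AB such that (⟨A,C,C'⟩ ∪ ⟨B,C,C'⟩) ∩ (∂Δ1 ∪ ∂Δ2) = ∅, and let Δ0' = ABC'. Then ∂Δ1 ∩ ⟨Δ0'⟩ = ∅, and both points of ∂Δ1 ∩ ⟨Δ2⟩ lie outside the tetrahedron ⟨A,B,C,C'⟩. -/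
open scoped Matrix

noncomputable section

lemma mem_hull3 (A B C x : Pt) : x ∈ convexHull ℝ ({A, B, C} : Set Pt) ↔
    ∃ a b c : ℝ, 0 ≤ a ∧ 0 ≤ b ∧ 0 ≤ c ∧ a + b + c = 1 ∧ a • A + b • B + c • C = x := by
  constructor
  · intro hx
    rw [convexHull_insert (by simp), mem_convexJoin] at hx
    obtain ⟨p, hp, q, hq, hx⟩ := hx
    rw [convexHull_pair] at hq
    simp only [Set.mem_singleton_iff] at hp
    subst hp
    obtain ⟨s, t, hs, ht, hst, rfl⟩ := hq
    obtain ⟨u, v, hu, hv, huv, rfl⟩ := hx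
    refine ⟨u, v * s, v * t, hu, by positivity, by positivity, ?_, ?_⟩
    · rw [add_assoc, ← mul_add, hst, mul_one, huv]
    · module
  · rintro ⟨a, b, c, ha, hb, hc, h, rfl⟩
    have := (convex_convexHull ℝ ({A, B, C} : Set Pt)).sum_mem (t := Finset.univ)
      (w := ![a, b, c]) (z := ![A, B, C])
      (by intro i _; fin_cases i <;> simpa) (by simp [Fin.sum_univ_three, h])
      (by intro i _; apply subset_convexHull; fin_cases i <;> simp)
    simpa [Fin.sum_univ_three] using this

lemma mem_hull4 (A B C D x : Pt) (hx : x ∈ convexHull ℝ ({A, B, C, D} : Set Pt)) :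
    ∃ a b c d : ℝ, 0 ≤ a ∧ 0 ≤ b ∧ 0 ≤ c ∧ 0 ≤ d ∧ a + b + c + d = 1 ∧
      a • A + b • B + c • C + d • D = x := by
  rw [convexHull_insert (by simp), mem_convexJoin] at hx
  obtain ⟨p, hp, q, hq, hx⟩ := hx
  rw [mem_hull3] at hq
  simp only [Set.mem_singleton_iff] at hp
  subst hp
  obtain ⟨s, t, r, hs, ht, hr, hst, rfl⟩ := hq
  obtain ⟨u, v, hu, hv, huv, rfl⟩ := hx
  refine ⟨u, v * s, v * t, v * r, hu, by positivity, by positivity, by positivity, ?_, ?_⟩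
  · linear_combination huv + v * hst
  · module

lemma aff3 (f : Pt →ᵃ[ℝ] ℝ) (A B C : Pt) (a b c : ℝ) (h : a + b + c = 1) :
    f (a • A + b • B + c • C) = a * f A + b * f B + c * f C := by
  rw [f.decomp]
  simp only [Pi.add_apply, map_add, map_smul, smul_eq_mul]
  linear_combination (- f 0) * h

lemma aff4 (f : Pt →ᵃ[ℝ] ℝ) (A B C D : Pt) (a b c d : ℝ) (h : a + b + c + d = 1) :
    f (a • A + b • B + c • C + d • D) = a * f A + b * f B + c * f C + d * f D := by
  rw [f.decomp]
  simp only [Pi.add_apply, map_add, map_smul, smul_eq_mul]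
  linear_combination (- f 0) * h

lemma aff2 (f : Pt →ᵃ[ℝ] ℝ) (A B : Pt) (a b : ℝ) (h : a + b = 1) :
    f (a • A + b • B) = a * f A + b * f B := by
  simpa using Convex.combo_affine_apply (f := f) (x := A) (y := B) h

lemma seg01 (A B x : Pt) : x ∈ segment ℝ A B ↔
    ∃ a b : ℝ, 0 ≤ a ∧ 0 ≤ b ∧ a + b = 1 ∧ a • A + b • B = x := Iff.rfl

lemma mem_outl (A B C x : Pt) :
    x ∈ segment ℝ A B ∪ segment ℝ B C ∪ segment ℝ C A ↔
    ∃ a b c : ℝ, 0 ≤ a ∧ 0 ≤ b ∧ 0 ≤ c ∧ a + b + c = 1 ∧ (a = 0 ∨ b = 0 ∨ c = 0) ∧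
      a • A + b • B + c • C = x := by
  constructor
  · rintro ((⟨a, b, ha, hb, h, rfl⟩ | ⟨a, b, ha, hb, h, rfl⟩) | ⟨a, b, ha, hb, h, rfl⟩)
    · exact ⟨a, b, 0, ha, hb, le_rfl, by linarith, by simp, by module⟩
    · exact ⟨0, a, b, le_rfl, ha, hb, by linarith, by simp, by module⟩
    · exact ⟨b, 0, a, hb, le_rfl, ha, by linarith, by simp, by module⟩
  · rintro ⟨a, b, c, ha, hb, hc, h, (rfl | rfl | rfl), rfl⟩
    · exact Or.inl (Or.inr ⟨b, c, hb, hc, by linarith, by module⟩)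
    · exact Or.inr ⟨c, a, hc, ha, by linarith, by module⟩
    · exact Or.inl (Or.inl ⟨a, b, ha, hb, by linarith, by module⟩)

def dotL (v : Pt) : Pt →ₗ[ℝ] ℝ where
  toFun w := v ⬝ᵥ w
  map_add' := by intros; simp [dotProduct_add]
  map_smul' := by intros; simp

lemma chart (T : Tri) : ∃ f g0 g1 g2 : Pt →ᵃ[ℝ] ℝ,
    (∀ x, x ∈ T.hull ↔ f x = 0 ∧ 0 ≤ g0 x ∧ 0 ≤ g1 x ∧ 0 ≤ g2 x) ∧
    (∀ x, x ∈ T.outline ↔ f x = 0 ∧ 0 ≤ g0 x ∧ 0 ≤ g1 x ∧ 0 ≤ g2 x ∧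
      (g0 x = 0 ∨ g1 x = 0 ∨ g2 x = 0)) := by
  obtain ⟨A, B, C, hind⟩ := T
  set e0 := B - A with he0
  set e1 := C - A with he1
  set n := e0 ⨯₃ e1 with hn
  have hli : LinearIndependent ℝ ![e0, e1] := by
    rw [affineIndependent_iff_linearIndependent_vsub ℝ _ (0 : Fin 3)] at hind
    have := hind.comp (fun i : Fin 2 => (⟨i.succ, Fin.succ_ne_zero i⟩ : {x : Fin 3 // x ≠ 0}))
      (by intro i j h; simpa using h)
    have e : ![e0, e1] = ((fun i : {x : Fin 3 // x ≠ 0} => ![A, B, C] i -ᵥ ![A, B, C] 0) ∘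
        fun i : Fin 2 => (⟨i.succ, Fin.succ_ne_zero i⟩ : {x : Fin 3 // x ≠ 0})) := by
      ext i j
      fin_cases i <;> simp [he0, he1]
    rw [e]
    exact this
  have hn0 : n ≠ 0 := crossProduct_ne_zero_iff_linearIndependent.2 hli
  set N := n ⬝ᵥ n with hN
  have hN0 : N ≠ 0 := by
    simpa [hN] using hn0
  let f : Pt →ᵃ[ℝ] ℝ := (dotL n).toAffineMap - AffineMap.const ℝ _ (dotL n A)
  let g1 : Pt →ᵃ[ℝ] ℝ := (N⁻¹ • dotL (e1 ⨯₃ n)).toAffineMap -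
    AffineMap.const ℝ _ ((N⁻¹ • dotL (e1 ⨯₃ n)) A)
  let g2 : Pt →ᵃ[ℝ] ℝ := (N⁻¹ • dotL (n ⨯₃ e0)).toAffineMap -
    AffineMap.const ℝ _ ((N⁻¹ • dotL (n ⨯₃ e0)) A)
  let g0 : Pt →ᵃ[ℝ] ℝ := AffineMap.const ℝ _ 1 - g1 - g2
  have hf : ∀ x, f x = n ⬝ᵥ (x - A) := by
    intro x; simp [f, dotL, dotProduct_sub]
  have hg1 : ∀ x, g1 x = N⁻¹ * ((e1 ⨯₃ n) ⬝ᵥ (x - A)) := by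
    intro x; simp [g1, dotL, dotProduct_sub, mul_sub]
  have hg2 : ∀ x, g2 x = N⁻¹ * ((n ⨯₃ e0) ⬝ᵥ (x - A)) := by
    intro x; simp [g2, dotL, dotProduct_sub, mul_sub]
  have hg0 : ∀ x, g0 x = 1 - g1 x - g2 x := by
    intro x; simp [g0]
  have vA : f A = 0 ∧ g0 A = 1 ∧ g1 A = 0 ∧ g2 A = 0 := by
    simp [hf, hg0, hg1, hg2]
  have k1 : (e1 ⨯₃ n) ⬝ᵥ e0 = N := by
    simp [hN, hn, cross_apply, dotProduct, Fin.sum_univ_three]; ring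
  have k2 : (n ⨯₃ e0) ⬝ᵥ e1 = N := by
    simp [hN, hn, cross_apply, dotProduct, Fin.sum_univ_three]; ring
  have k3 : (n ⨯₃ e0) ⬝ᵥ e0 = 0 := by
    simp [hn, cross_apply, dotProduct, Fin.sum_univ_three]; ring
  have k4 : (e1 ⨯₃ n) ⬝ᵥ e1 = 0 := by
    simp [hn, cross_apply, dotProduct, Fin.sum_univ_three]; ring
  have k5 : n ⬝ᵥ e0 = 0 := by
    simp [hn, cross_apply, dotProduct, Fin.sum_univ_three]; ring
  have k6 : n ⬝ᵥ e1 = 0 := by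
    simp [hn, cross_apply, dotProduct, Fin.sum_univ_three]; ring
  have vB : f B = 0 ∧ g0 B = 0 ∧ g1 B = 1 ∧ g2 B = 0 := by
    simp [hf, hg0, hg1, hg2, ← he0, k1, k3, k5, hN0]
  have vC : f C = 0 ∧ g0 C = 0 ∧ g1 C = 0 ∧ g2 C = 1 := by
    simp [hf, hg0, hg1, hg2, ← he1, k2, k4, k6, hN0]
  have key : ∀ w : Pt, N • w = ((e1 ⨯₃ n) ⬝ᵥ w) • e0 + ((n ⨯₃ e0) ⬝ᵥ w) • e1 +
      (n ⬝ᵥ w) • n := by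
    intro w
    rw [hN]
    ext i
    fin_cases i <;>
    simp [hn, cross_apply, dotProduct, Fin.sum_univ_three] <;> ring
  have rep : ∀ x, f x = 0 → x = g0 x • A + g1 x • B + g2 x • C := by
    intro x hx
    have h := key (x - A)
    rw [hf] at hx
    rw [hx, zero_smul, add_zero] at h
    have h2 : x - A = g1 x • e0 + g2 x • e1 := by
      rw [hg1, hg2, mul_smul, mul_smul, ← smul_add, ← h, smul_smul, inv_mul_cancel₀ hN0, one_smul]
    have h3 : x = A + (g1 x • e0 + g2 x • e1) := by rw [← h2]; simp
    nth_rewrite 1 [h3]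
    rw [hg0, he0, he1]; module
  have co : ∀ a b c : ℝ, a + b + c = 1 → f (a • A + b • B + c • C) = 0 ∧
      g0 (a • A + b • B + c • C) = a ∧ g1 (a • A + b • B + c • C) = b ∧
      g2 (a • A + b • B + c • C) = c := by
    intro a b c h
    simp only [aff3 _ A B C a b c h, vA, vB, vC]
    simp
  refine ⟨f, g0, g1, g2, ?_, ?_⟩
  · intro x
    simp only [Tri.hull, mem_hull3]
    constructor
    · rintro ⟨a, b, c, ha, hb, hc, h, rfl⟩
      obtain ⟨h1, h2, h3, h4⟩ := co a b c h
      rw [h1, h2, h3, h4]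
      exact ⟨rfl, ha, hb, hc⟩
    · rintro ⟨h1, h2, h3, h4⟩
      exact ⟨_, _, _, h2, h3, h4, by rw [hg0]; ring, (rep x h1).symm⟩
  · intro x
    simp only [Tri.outline, mem_outl]
    constructor
    · rintro ⟨a, b, c, ha, hb, hc, h, h0, rfl⟩
      obtain ⟨h1, h2, h3, h4⟩ := co a b c h
      rw [h1, h2, h3, h4]
      exact ⟨rfl, ha, hb, hc, h0⟩
    · rintro ⟨h1, h2, h3, h4, h5⟩
      exact ⟨_, _, _, h2, h3, h4, by rw [hg0]; ring, h5, (rep x h1).symm⟩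

def InU (f g0 g1 g2 : Pt →ᵃ[ℝ] ℝ) (x : Pt) : Prop := f x = 0 ∧ 0 < g0 x ∧ 0 < g1 x ∧ 0 < g2 x

def InO (f g0 g1 g2 : Pt →ᵃ[ℝ] ℝ) (x : Pt) : Prop := f x = 0 ∧ 0 ≤ g0 x ∧ 0 ≤ g1 x ∧ 0 ≤ g2 x ∧
      (g0 x = 0 ∨ g1 x = 0 ∨ g2 x = 0)

lemma InU.convex (f g0 g1 g2 : Pt →ᵃ[ℝ] ℝ) : Convex ℝ {x | InU f g0 g1 g2 x} := by
  rintro x ⟨h1, h2, h3, h4⟩ y ⟨k1, k2, k3, k4⟩ a b ha hb hab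
  have : ∀ p q : ℝ, 0 < p → 0 < q → 0 < a * p + b * q := by
    intro p q hp hq
    rcases ha.eq_or_lt with rfl | ha
    · have : b = 1 := by linarith
      subst this; linarith
    · have := mul_pos ha hp
      have := mul_nonneg hb hq.le
      linarith
  refine ⟨?_, ?_, ?_, ?_⟩ <;> rw [aff2 _ _ _ _ _ hab]
  · rw [h1, k1]; simp
  all_goals apply this <;> assumption

lemma prop_U (f g0 g1 g2 : Pt →ᵃ[ℝ] ℝ) (G : Set Pt) (hG : Convex ℝ G)
    (hO : ∀ x ∈ G, ¬ InO f g0 g1 g2 x) (p q : Pt) (hp : p ∈ G) (hpU : InU f g0 g1 g2 p)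
    (hq : q ∈ G) (hf : f q = 0) : InU f g0 g1 g2 q := by
  by_contra hn
  let m : ℝ → ℝ := fun t => min ((1 - t) * g0 p + t * g0 q)
    (min ((1 - t) * g1 p + t * g1 q) ((1 - t) * g2 p + t * g2 q))
  have hc : ContinuousOn m (Set.Icc 0 1) := by
    apply Continuous.continuousOn; fun_prop
  have h0 : 0 < m 0 := by
    obtain ⟨_, h2, h3, h4⟩ := hpU
    simp [m, h2, h3, h4]
  have h1 : m 1 ≤ 0 := by
    by_contra h
    push Not at h
    simp [m] at h
    exact hn ⟨hf, h⟩
  obtain ⟨t, ⟨ht0, ht1⟩, ht⟩ := intermediate_value_Icc' zero_le_one hc ⟨h1, h0.le⟩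
  have hab : (1 - t) + t = 1 := by ring
  apply hO _ (hG hp hq (by linarith : 0 ≤ 1 - t) ht0 hab)
  simp only [InO, aff2 _ _ _ _ _ hab, hf, hpU.1]
  simp only [m] at ht
  generalize (1 - t) * g0 p + t * g0 q = x at *
  generalize (1 - t) * g1 p + t * g1 q = y at *
  generalize (1 - t) * g2 p + t * g2 q = z at *
  refine ⟨by simp, ?_, ?_, ?_, ?_⟩
  · rw [← ht]; simp
  · rw [← ht]; simp
  · rw [← ht]; simp
  · rcases min_choice x (min y z) with h | h
    · left; linarith
    · rw [h] at ht
      rcases min_choice y z with h | h <;> rw [h] at ht <;> simp [ht]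

/-- A segment in the plane of the chart with a point of the open triangle has many points in it. -/
lemma edge_contra (f g0 g1 g2 : Pt →ᵃ[ℝ] ℝ) (V W P Q p : Pt) (hVW : V ≠ W) (hpPQ : p = P ∨ p = Q)
    (hV : f V = 0) (hW : f W = 0) (hp : p ∈ segment ℝ V W) (hpU : InU f g0 g1 g2 p)
    (hfin : ∀ x ∈ segment ℝ V W, InU f g0 g1 g2 x → x = P ∨ x = Q) : False := by
  have main : ∀ Z ∈ segment ℝ V W, f Z = 0 → Z = p := by
    intro Z hZ hfZ
    have ev : ∀ g : Pt →ᵃ[ℝ] ℝ, 0 < g p → ∀ᶠ t : ℝ in nhdsWithin 0 (Set.Ioi 0),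
        0 < (1 - t) * g p + t * g Z := by
      intro g hg
      apply Filter.Eventually.filter_mono nhdsWithin_le_nhds
      have : Continuous fun t : ℝ => (1 - t) * g p + t * g Z := by fun_prop
      apply this.continuousAt.eventually (lt_mem_nhds _)
      simpa using hg
    have e1 : ∀ᶠ t : ℝ in nhdsWithin 0 (Set.Ioi 0), t ∈ Set.Ioo (0:ℝ) 1 :=
      Ioo_mem_nhdsGT one_pos
    obtain ⟨t, ⟨⟨⟨ht, ht1⟩, a0⟩, a1⟩, a2⟩ := (((e1.and (ev g0 hpU.2.1)).and (ev g1 hpU.2.2.1)).and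
      (ev g2 hpU.2.2.2)).exists
    have hab : (1 - t) + t = 1 := by ring
    have hU1 : InU f g0 g1 g2 ((1 - t) • p + t • Z) := by
      simp only [InU, aff2 _ _ _ _ _ hab, hfZ, hpU.1]
      exact ⟨by simp, a0, a1, a2⟩
    have hS1 : (1 - t) • p + t • Z ∈ segment ℝ V W :=
      convex_segment V W hp hZ (by linarith) ht.le hab
    have hc : ((1:ℝ)/2) + 1/2 = 1 := by norm_num
    have hU2 := InU.convex f g0 g1 g2 hpU hU1 (by norm_num) (by norm_num) hc
    have hS2 := convex_segment V W hp hS1 (by norm_num) (by norm_num) hc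
    have q1 := hfin _ hS1 hU1
    have q2 := hfin _ hS2 hU2
    by_contra hne
    have d1 : (1 - t) • p + t • Z ≠ p := by
      intro h
      have : t • (Z - p) = 0 := by
        rw [← sub_eq_zero] at h; rw [← h]; module
      rcases smul_eq_zero.1 this with h | h
      · linarith
      · exact hne (sub_eq_zero.1 h)
    set y := (1 - t) • p + t • Z with hy
    have d2 : ((1:ℝ)/2) • p + ((1:ℝ)/2) • y ≠ p := by
      intro h
      apply d1
      have : ((1:ℝ)/2) • (y - p) = 0 := by
        rw [← sub_eq_zero] at h; rw [← h]; module
      rcases smul_eq_zero.1 this with h | h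
      · norm_num at h
      · exact (sub_eq_zero.1 h)
    have d3 : ((1:ℝ)/2) • p + ((1:ℝ)/2) • y ≠ y := by
      intro h
      apply d1
      have : ((1:ℝ)/2) • (y - p) = 0 := by
        rw [← sub_eq_zero] at h; rw [← neg_eq_zero, ← h]; module
      rcases smul_eq_zero.1 this with h | h
      · norm_num at h
      · exact (sub_eq_zero.1 h)
    grind
  have h1 := main V (left_mem_segment ℝ V W) hV
  have h2 := main W (right_mem_segment ℝ V W) hW
  exact hVW (h1.trans h2.symm)

/-- generic case, `A` is the lonely vertex -/
lemma lonely (f : Pt →ᵃ[ℝ] ℝ) (A B C : Pt) (ha : f A ≠ 0) (hb : f A * f B ≤ 0)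
    (hc : f A * f C ≤ 0) (hbc : ¬ (f B = 0 ∧ f C = 0)) :
    ∃ y z : Pt, ∀ a b c : ℝ, 0 ≤ a → 0 ≤ b → 0 ≤ c → a + b + c = 1 →
      f (a • A + b • B + c • C) = 0 → a • A + b • B + c • C ∈ segment ℝ y z ∧
      ((a = 0 ∨ b = 0 ∨ c = 0) → a • A + b • B + c • C = y ∨ a • A + b • B + c • C = z) := by
  obtain ⟨b', hb'⟩ : ∃ b', b' = - f B / f A := ⟨_, rfl⟩
  obtain ⟨c', hc'⟩ : ∃ c', c' = - f C / f A := ⟨_, rfl⟩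
  have fB : f B = - b' * f A := by rw [hb']; field_simp
  have fC : f C = - c' * f A := by rw [hc']; field_simp
  have hsq : 0 < f A * f A := mul_self_pos.2 ha
  have b0 : 0 ≤ b' := by
    by_contra h; push Not at h; rw [fB] at hb; nlinarith
  have c0 : 0 ≤ c' := by
    by_contra h; push Not at h; rw [fC] at hc; nlinarith
  have hbc' : ¬ (b' = 0 ∧ c' = 0) := by
    rintro ⟨h1, h2⟩; apply hbc; rw [fB, fC, h1, h2]; simp
  have b1 : 1 + b' ≠ 0 := by positivity
  have c1 : 1 + c' ≠ 0 := by positivity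
  refine ⟨(1 + b')⁻¹ • (b' • A + B), (1 + c')⁻¹ • (c' • A + C), ?_⟩
  intro a b c ha0 hb0 hc0 h hf
  rw [aff3 _ _ _ _ _ _ _ h, fB, fC] at hf
  have hA : a = b * b' + c * c' := by
    apply mul_right_cancel₀ ha; linear_combination hf
  have hx : a • A + b • B + c • C = (b * (1 + b')) • ((1 + b')⁻¹ • (b' • A + B)) +
      (c * (1 + c')) • ((1 + c')⁻¹ • (c' • A + C)) := by
    rw [smul_smul, smul_smul, mul_assoc, mul_assoc, mul_inv_cancel₀ b1, mul_inv_cancel₀ c1, hA]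
    module
  have hs : b * (1 + b') + c * (1 + c') = 1 := by linear_combination h - hA
  constructor
  · exact ⟨_, _, by positivity, by positivity, hs, hx.symm⟩
  · intro h0
    have : b = 0 ∨ c = 0 := by
      rcases h0 with h0 | h0 | h0
      · rw [h0] at hA
        have p1 : 0 ≤ b * b' := by positivity
        have p2 : 0 ≤ c * c' := by positivity
        have q1 : b * b' = 0 := by linarith
        have q2 : c * c' = 0 := by linarith
        rw [mul_eq_zero] at q1 q2
        tauto
      · exact Or.inl h0
      · exact Or.inr h0
    rcases this with h0 | h0
    · right
      rw [hx]
      rw [h0] at hs ⊢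
      have : c * (1 + c') = 1 := by linarith
      rw [this]; simp
    · left
      rw [hx]
      rw [h0] at hs ⊢
      have : b * (1 + b') = 1 := by linarith
      rw [this]; simp

def IsOut (A B C x : Pt) : Prop := ∃ a b c : ℝ, 0 ≤ a ∧ 0 ≤ b ∧ 0 ≤ c ∧ a + b + c = 1 ∧
  (a = 0 ∨ b = 0 ∨ c = 0) ∧ a • A + b • B + c • C = x

def IsHull (A B C x : Pt) : Prop := ∃ a b c : ℝ, 0 ≤ a ∧ 0 ≤ b ∧ 0 ≤ c ∧ a + b + c = 1 ∧
  a • A + b • B + c • C = x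

lemma IsOut.rot {A B C x : Pt} (h : IsOut A B C x) : IsOut B C A x := by
  obtain ⟨a, b, c, ha, hb, hc, h, h0, rfl⟩ := h
  exact ⟨b, c, a, hb, hc, ha, by linarith, by tauto, by module⟩

lemma IsHull.rot {A B C x : Pt} (h : IsHull A B C x) : IsHull B C A x := by
  obtain ⟨a, b, c, ha, hb, hc, h, rfl⟩ := h
  exact ⟨b, c, a, hb, hc, ha, by linarith, by module⟩

/-- First case: `A` is lonely or `A` is the only zero. -/
lemma caseA (f g0 g1 g2 : Pt →ᵃ[ℝ] ℝ) (A B C P Q : Pt) (hPQ : P ≠ Q)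
    (hP : IsOut A B C P) (hQ : IsOut A B C Q) (hPU : InU f g0 g1 g2 P) (hQU : InU f g0 g1 g2 Q)
    (hbc : ¬ (f B = 0 ∧ f C = 0))
    (hl : (f A ≠ 0 ∧ f A * f B ≤ 0 ∧ f A * f C ≤ 0) ∨ (f A = 0 ∧ 0 < f B * f C))
    (x : Pt) (hx : IsHull A B C x) (hfx : f x = 0) : InU f g0 g1 g2 x := by
  rcases hl with ⟨h1, h2, h3⟩ | ⟨h1, h2⟩
  · obtain ⟨y, z, hyz⟩ := lonely f A B C h1 h2 h3 hbc
    obtain ⟨a, b, c, ha, hb, hc, h, rfl⟩ := hx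
    have k := (hyz a b c ha hb hc h hfx).1
    have kP : P = y ∨ P = z := by
      obtain ⟨a, b, c, ha, hb, hc, h, h0, rfl⟩ := hP
      exact (hyz a b c ha hb hc h hPU.1).2 h0
    have kQ : Q = y ∨ Q = z := by
      obtain ⟨a, b, c, ha, hb, hc, h, h0, rfl⟩ := hQ
      exact (hyz a b c ha hb hc h hQU.1).2 h0
    have hy : InU f g0 g1 g2 y := by grind
    have hz : InU f g0 g1 g2 z := by grind
    exact (InU.convex f g0 g1 g2).segment_subset hy hz k
  · exfalso
    have : ∀ x, IsOut A B C x → f x = 0 → x = A := by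
      rintro x ⟨a, b, c, ha, hb, hc, h, h0, rfl⟩ hf
      rw [aff3 _ _ _ _ _ _ _ h, h1] at hf
      have hB : f B ≠ 0 := by rintro h; simp [h] at h2
      have hC : f C ≠ 0 := by rintro h; simp [h] at h2
      have e1 : b * (f B * f B) + c * (f B * f C) = 0 := by linear_combination f B * hf
      have p1 : 0 < f B * f B := mul_self_pos.2 hB
      have q1 : 0 ≤ b * (f B * f B) := by positivity
      have q2 : 0 ≤ c * (f B * f C) := by positivity
      have b0 : b = 0 := by
        have : b * (f B * f B) = 0 := by linarith
        rcases mul_eq_zero.1 this with h | h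
        · exact h
        · linarith
      have c0 : c = 0 := by
        have : c * (f B * f C) = 0 := by linarith
        rcases mul_eq_zero.1 this with h | h
        · exact h
        · linarith
      subst b0; subst c0
      have : a = 1 := by linarith
      subst this; simp
    exact hPQ ((this P hP hPU.1).trans (this Q hQ hQU.1).symm)

lemma out_seg {A B C x : Pt} (hx : IsOut A B C x) (f : Pt →ᵃ[ℝ] ℝ) (hx0 : f x = 0)
    (hA : f A = 0) (hB : f B = 0) :
    (x ∈ segment ℝ A B) ∨ (f C = 0 ∧ (x ∈ segment ℝ B C ∨ x ∈ segment ℝ C A)) := by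
  by_cases hC : f C = 0
  · have := (mem_outl A B C x).2 hx
    rcases this with (h | h) | h <;> tauto
  · left
    obtain ⟨a, b, c, ha, hb, hc, h, h0, rfl⟩ := hx
    rw [aff3 _ _ _ _ _ _ _ h, hA, hB] at hx0
    have : c = 0 := by
      have : c * f C = 0 := by linarith
      exact (mul_eq_zero.1 this).resolve_right hC
    subst this
    exact ⟨a, b, ha, hb, by linarith, by simp⟩

lemma two_zero (f g0 g1 g2 : Pt →ᵃ[ℝ] ℝ) (A B C P Q : Pt)
    (hAB : A ≠ B) (hBC : B ≠ C) (hCA : C ≠ A)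
    (hP : IsOut A B C P) (hPU : InU f g0 g1 g2 P)
    (hfin : ∀ x, IsOut A B C x → InU f g0 g1 g2 x → x = P ∨ x = Q)
    (hA : f A = 0) (hB : f B = 0) : False := by
  have hs : ∀ x ∈ segment ℝ A B ∪ segment ℝ B C ∪ segment ℝ C A, InU f g0 g1 g2 x →
      x = P ∨ x = Q := fun x hx => hfin x ((mem_outl A B C x).1 hx)
  rcases out_seg hP f hPU.1 hA hB with h | ⟨hC, h | h⟩
  · exact edge_contra f g0 g1 g2 A B P Q P hAB (Or.inl rfl) hA hB h hPU
      (fun x hx => hs x (Or.inl (Or.inl hx)))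
  · exact edge_contra f g0 g1 g2 B C P Q P hBC (Or.inl rfl) hB hC h hPU
      (fun x hx => hs x (Or.inl (Or.inr hx)))
  · exact edge_contra f g0 g1 g2 C A P Q P hCA (Or.inl rfl) hC hA h hPU
      (fun x hx => hs x (Or.inr hx))

lemma hull_U (f g0 g1 g2 : Pt →ᵃ[ℝ] ℝ) (A B C P Q : Pt) (hPQ : P ≠ Q)
    (hAB : A ≠ B) (hBC : B ≠ C) (hCA : C ≠ A)
    (hP : IsOut A B C P) (hQ : IsOut A B C Q) (hPU : InU f g0 g1 g2 P) (hQU : InU f g0 g1 g2 Q)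
    (hfin : ∀ x, IsOut A B C x → InU f g0 g1 g2 x → x = P ∨ x = Q)
    (x : Pt) (hx : IsHull A B C x) (hfx : f x = 0) : InU f g0 g1 g2 x := by
  have z1 : ¬ (f A = 0 ∧ f B = 0) := fun h =>
    two_zero f g0 g1 g2 A B C P Q hAB hBC hCA hP hPU hfin h.1 h.2
  have z2 : ¬ (f B = 0 ∧ f C = 0) := fun h =>
    two_zero f g0 g1 g2 B C A P Q hBC hCA hAB hP.rot hPU (fun x hx => hfin x hx.rot.rot) h.1 h.2
  have z3 : ¬ (f C = 0 ∧ f A = 0) := fun h =>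
    two_zero f g0 g1 g2 C A B P Q hCA hAB hBC hP.rot.rot hPU (fun x hx => hfin x hx.rot) h.1 h.2
  have nz : ¬ (0 < f A * f B ∧ 0 < f B * f C ∧ 0 < f C * f A) := by
    rintro ⟨h1, h2, h3⟩
    obtain ⟨a, b, c, ha, hb, hc, h, rfl⟩ := hx
    rw [aff3 _ _ _ _ _ _ _ h] at hfx
    have hA : f A ≠ 0 := by rintro h; simp [h] at h1
    have e : a * (f A * f A) + b * (f A * f B) + c * (f C * f A) = 0 := by
      linear_combination f A * hfx
    have p0 : 0 < f A * f A := mul_self_pos.2 hA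
    have q0 : 0 ≤ a * (f A * f A) := by positivity
    have q1 : 0 ≤ b * (f A * f B) := by positivity
    have q2 : 0 ≤ c * (f C * f A) := by positivity
    have a0 : a = 0 := by nlinarith
    have b0 : b = 0 := by nlinarith
    have c0 : c = 0 := by nlinarith
    subst a0; subst b0; subst c0; norm_num at h
  have tri : ((f A ≠ 0 ∧ f A * f B ≤ 0 ∧ f A * f C ≤ 0) ∨ (f A = 0 ∧ 0 < f B * f C)) ∨
      ((f B ≠ 0 ∧ f B * f C ≤ 0 ∧ f B * f A ≤ 0) ∨ (f B = 0 ∧ 0 < f C * f A)) ∨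
      ((f C ≠ 0 ∧ f C * f A ≤ 0 ∧ f C * f B ≤ 0) ∨ (f C = 0 ∧ 0 < f A * f B)) := by
    generalize f A = a at *
    generalize f B = b at *
    generalize f C = c at *
    clear hfin hfx
    rcases lt_trichotomy a 0 with ha | ha | ha <;> rcases lt_trichotomy b 0 with hb | hb | hb <;>
    rcases lt_trichotomy c 0 with hc | hc | hc <;>
    simp_all [mul_pos_iff, mul_nonpos_iff, le_of_lt, ne_of_lt, ne_of_gt, not_lt_of_gt]
  rcases tri with h | h | h
  · exact caseA f g0 g1 g2 A B C P Q hPQ hP hQ hPU hQU z2 h x hx hfx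
  · exact caseA f g0 g1 g2 B C A P Q hPQ hP.rot hQ.rot hPU hQU z3 h x hx.rot hfx
  · exact caseA f g0 g1 g2 C A B P Q hPQ hP.rot.rot hQ.rot.rot hPU hQU z1 h x hx.rot.rot hfx

lemma edge_zero (f : Pt →ᵃ[ℝ] ℝ) (V W : Pt) (h : f V * f W ≤ 0) :
    ∃ p ∈ segment ℝ V W, f p = 0 := by
  by_cases hd : f V = f W
  · have : f V = 0 := by rw [← hd] at h; nlinarith
    exact ⟨V, left_mem_segment ℝ V W, this⟩
  · have hd' : f V - f W ≠ 0 := sub_ne_zero.2 hd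
    have hs : -f W / (f V - f W) + f V / (f V - f W) = 1 := by field_simp; ring
    refine ⟨(-f W / (f V - f W)) • V + (f V / (f V - f W)) • W, ⟨_, _, ?_, ?_, hs, rfl⟩, ?_⟩
    · rw [div_eq_mul_inv, ← div_eq_mul_inv, ← mul_div_mul_right _ _ hd']
      apply div_nonneg <;> nlinarith [sq_nonneg (f V), sq_nonneg (f W), sq_nonneg (f V - f W)]
    · rw [← mul_div_mul_right _ _ hd']
      apply div_nonneg <;> nlinarith [sq_nonneg (f V), sq_nonneg (f W), sq_nonneg (f V - f W)]
    · rw [aff2 _ _ _ _ _ hs]; field_simp; ring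

lemma same_sign (f : Pt →ᵃ[ℝ] ℝ) (A B C x : Pt) (hx : IsHull A B C x) (h1 : 0 < f A * f B)
    (h3 : 0 < f C * f A) : f x ≠ 0 := by
  intro hfx
  obtain ⟨a, b, c, ha, hb, hc, h, rfl⟩ := hx
  rw [aff3 _ _ _ _ _ _ _ h] at hfx
  have hA : f A ≠ 0 := by rintro h; simp [h] at h1
  have e : a * (f A * f A) + b * (f A * f B) + c * (f C * f A) = 0 := by
    linear_combination f A * hfx
  have p0 : 0 < f A * f A := mul_self_pos.2 hA
  have q0 : 0 ≤ a * (f A * f A) := by positivity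
  have q1 : 0 ≤ b * (f A * f B) := by positivity
  have q2 : 0 ≤ c * (f C * f A) := by positivity
  have a0 : a = 0 := by nlinarith
  have b0 : b = 0 := by nlinarith
  have c0 : c = 0 := by nlinarith
  subst a0; subst b0; subst c0; norm_num at h

lemma exit_pt (a b c u v w : ℝ) (ha : 0 ≤ a) (hb : 0 ≤ b) (hc : 0 ≤ c)
    (hs : u + v + w = 0) (hne : ¬ (u = 0 ∧ v = 0 ∧ w = 0)) :
    ∃ t : ℝ, 0 ≤ t ∧ 0 ≤ a + t * u ∧ 0 ≤ b + t * v ∧ 0 ≤ c + t * w ∧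
      (a + t * u = 0 ∨ b + t * v = 0 ∨ c + t * w = 0) := by
  let l : Fin 3 → ℝ := ![a, b, c]
  let m : Fin 3 → ℝ := ![u, v, w]
  have hl : ∀ i, 0 ≤ l i := by intro i; fin_cases i <;> simpa [l]
  have hne' : (Finset.univ.filter fun i => m i < 0).Nonempty := by
    by_contra h
    rw [Finset.not_nonempty_iff_eq_empty, Finset.filter_eq_empty_iff] at h
    have h0 : ¬ u < 0 := h (x := 0) (Finset.mem_univ _)
    have h1 : ¬ v < 0 := h (x := 1) (Finset.mem_univ _)
    have h2 : ¬ w < 0 := h (x := 2) (Finset.mem_univ _)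
    exact hne ⟨by linarith, by linarith, by linarith⟩
  obtain ⟨i, hi, hmin⟩ := Finset.exists_min_image _ (fun i => l i / (- m i)) hne'
  have hi : m i < 0 := by simpa using hi
  have ht : 0 ≤ l i / (- m i) := div_nonneg (hl i) (by linarith)
  have hpos : ∀ j, 0 ≤ l j + l i / (- m i) * m j := by
    intro j
    by_cases hj : m j < 0
    · have := hmin j (by simpa using hj)
      rw [le_div_iff₀ (by linarith)] at this
      linarith
    · push Not at hj
      have := hl j
      positivity
  have hz : l i + l i / (- m i) * m i = 0 := by
    have : m i ≠ 0 := hi.ne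
    field_simp; ring
  refine ⟨l i / (- m i), ht, hpos 0, hpos 1, hpos 2, ?_⟩
  have : ∀ t, l i + t * m i = 0 → (a + t * u = 0 ∨ b + t * v = 0 ∨ c + t * w = 0) := by
    intro t h
    fin_cases i
    · left; exact h
    · right; left; exact h
    · right; right; exact h
  exact this _ hz

/-- The section of a tetrahedron is within the hull of its sections with the three faces at `C`. -/
lemma tetra (f : Pt →ᵃ[ℝ] ℝ) (A B C D : Pt) (S : Set Pt) (hS : Convex ℝ S)
    (h1 : ∀ x, IsHull A B C x → f x = 0 → x ∈ S) (h2 : ∀ x, IsHull A C D x → f x = 0 → x ∈ S)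
    (h3 : ∀ x, IsHull B C D x → f x = 0 → x ∈ S) (a b c d : ℝ) (ha : 0 ≤ a) (hb : 0 ≤ b)
    (hc : 0 ≤ c) (hd : 0 ≤ d) (h : a + b + c + d = 1) (hf : f (a • A + b • B + c • C + d • D) = 0) :
    a • A + b • B + c • C + d • D ∈ S := by
  obtain ⟨u, v, w, hs, hne, hfm⟩ : ∃ u v w : ℝ, u + v + w = 0 ∧ ¬ (u = 0 ∧ v = 0 ∧ w = 0) ∧
      u * f A + v * f B + w * f D = 0 := by
    by_cases h : f B - f D = 0 ∧ f D - f A = 0 ∧ f A - f B = 0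
    · exact ⟨1, -1, 0, by norm_num, by norm_num, by linarith⟩
    · exact ⟨_, _, _, by ring, h, by ring⟩
  have inF : ∀ a b d : ℝ, 0 ≤ a → 0 ≤ b → 0 ≤ d → a + b + c + d = 1 → (a = 0 ∨ b = 0 ∨ d = 0) →
      f (a • A + b • B + c • C + d • D) = 0 → a • A + b • B + c • C + d • D ∈ S := by
    intro a b d ha hb hd h h0 hf
    rcases h0 with rfl | rfl | rfl
    · exact h3 _ ⟨b, c, d, hb, hc, hd, by linarith, by module⟩ hf
    · exact h2 _ ⟨a, c, d, ha, hc, hd, by linarith, by module⟩ hf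
    · exact h1 _ ⟨a, b, c, ha, hb, hc, by linarith, by module⟩ hf
  obtain ⟨t, t0, ta, tb, td, tz⟩ := exit_pt a b d u v w ha hb hd hs hne
  obtain ⟨s, s0, sa, sb, sd, sz⟩ := exit_pt a b d (-u) (-v) (-w) ha hb hd (by linarith)
    (by simpa using hne)
  rw [aff4 _ _ _ _ _ _ _ _ _ h] at hf
  have ht : (a + t * u) + (b + t * v) + c + (d + t * w) = 1 := by linear_combination h + t * hs
  have hs' : (a + s * -u) + (b + s * -v) + c + (d + s * -w) = 1 := by
    linear_combination h - s * hs
  have y := inF _ _ _ ta tb td ht tz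
    (by rw [aff4 _ _ _ _ _ _ _ _ _ ht]; linear_combination hf + t * hfm)
  have z := inF _ _ _ sa sb sd hs' sz
    (by rw [aff4 _ _ _ _ _ _ _ _ _ hs']; linear_combination hf - s * hfm)
  by_cases h0 : t = 0
  · subst h0
    simpa using y
  have tp : 0 < t := lt_of_le_of_ne t0 (Ne.symm h0)
  have hts : t + s ≠ 0 := by positivity
  have hab : s / (t + s) + t / (t + s) = 1 := by field_simp; ring
  have := hS y z (a := s / (t + s)) (b := t / (t + s)) (by positivity) (by positivity) hab
  convert this using 1
  have e3 : s / (t + s) * t = t / (t + s) * s := by ring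
  generalize s / (t + s) = p at *
  generalize t / (t + s) = q at *
  have cA : p * (a + t * u) + q * (a + s * -u) = a := by linear_combination a * hab + u * e3
  have cB : p * (b + t * v) + q * (b + s * -v) = b := by linear_combination b * hab + v * e3
  have cC : p * c + q * c = c := by linear_combination c * hab
  have cD : p * (d + t * w) + q * (d + s * -w) = d := by linear_combination d * hab + w * e3
  trans (p * (a + t * u) + q * (a + s * -u)) • A + (p * (b + t * v) + q * (b + s * -v)) • B +
    (p * c + q * c) • C + (p * (d + t * w) + q * (d + s * -w)) • D
  · rw [cA, cB, cC, cD]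
  · module

lemma main_disj (f g0 g1 g2 : Pt →ᵃ[ℝ] ℝ) (A B C D P : Pt)
    (hP : IsHull A B C P) (hPU : InU f g0 g1 g2 P)
    (H1 : ∀ x, IsHull A B C x → ¬ InO f g0 g1 g2 x)
    (H2 : ∀ x, IsHull A C D x → ¬ InO f g0 g1 g2 x)
    (H3 : ∀ x, IsHull B C D x → ¬ InO f g0 g1 g2 x)
    (x : Pt) (hx : x ∈ convexHull ℝ ({A, B, C, D} : Set Pt)) : ¬ InO f g0 g1 g2 x := by
  have cv : ∀ A B C : Pt, Convex ℝ {x | IsHull A B C x} := by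
    intro A B C
    have e : {x | IsHull A B C x} = convexHull ℝ ({A, B, C} : Set Pt) :=
      Set.ext fun x => (mem_hull3 A B C x).symm
    rw [e]
    exact convex_convexHull ℝ _
  have sg : ∀ A B C x : Pt, x ∈ segment ℝ A B → IsHull A B C x := by
    rintro A B C x ⟨a, b, ha, hb, h, rfl⟩
    exact ⟨a, b, 0, ha, hb, le_rfl, by linarith, by simp⟩
  have G : ∀ A B C p, (∀ x, IsHull A B C x → ¬ InO f g0 g1 g2 x) → IsHull A B C p →
      InU f g0 g1 g2 p → ∀ q, IsHull A B C q → f q = 0 → InU f g0 g1 g2 q := by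
    intro A B C p hO hp hU q hq hfq
    exact prop_U f g0 g1 g2 _ (cv A B C) hO p q hp hU hq hfq
  have U1 := G A B C P H1 hP hPU
  -- links between faces
  have L2 : f A * f C ≤ 0 → ∀ q, IsHull A C D q → f q = 0 → InU f g0 g1 g2 q := by
    intro h
    obtain ⟨p, hp, hp0⟩ := edge_zero f A C h
    exact G A C D p H2 (sg _ _ _ _ hp) (U1 p (sg C A B p (segment_symm ℝ A C ▸ hp)).rot hp0)
  have L3 : f B * f C ≤ 0 → ∀ q, IsHull B C D q → f q = 0 → InU f g0 g1 g2 q := by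
    intro h
    obtain ⟨p, hp, hp0⟩ := edge_zero f B C h
    exact G B C D p H3 (sg _ _ _ _ hp) (U1 p (sg B C A p hp).rot.rot hp0)
  have U23 : (∀ q, IsHull A C D q → f q = 0 → InU f g0 g1 g2 q) ∧
      (∀ q, IsHull B C D q → f q = 0 → InU f g0 g1 g2 q) := by
    by_cases hA : f A * f C ≤ 0
    · refine ⟨L2 hA, ?_⟩
      by_cases hB : f B * f C ≤ 0
      · exact L3 hB
      by_cases hD : f C * f D ≤ 0
      · obtain ⟨p, hp, hp0⟩ := edge_zero f C D hD
        exact G B C D p H3 (sg C D B p hp).rot.rot (L2 hA p (sg C D A p hp).rot.rot hp0)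
      · intro q hq h0
        exact absurd h0 (same_sign f C D B q hq.rot (by linarith) (by linarith))
    · by_cases hB : f B * f C ≤ 0
      · refine ⟨?_, L3 hB⟩
        by_cases hD : f C * f D ≤ 0
        · obtain ⟨p, hp, hp0⟩ := edge_zero f C D hD
          exact G A C D p H2 (sg C D A p hp).rot.rot (L3 hB p (sg C D B p hp).rot.rot hp0)
        · intro q hq h0
          exact absurd h0 (same_sign f C D A q hq.rot (by linarith) (by linarith))
      · exact absurd hPU.1 (same_sign f C A B P hP.rot.rot (by linarith) (by linarith))
  intro hO
  obtain ⟨a, b, c, d, ha, hb, hc, hd, h, rfl⟩ := mem_hull4 A B C D x hx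
  have hU := tetra f A B C D _ (InU.convex f g0 g1 g2) U1 U23.1 U23.2 a b c d ha hb hc hd h hO.1
  obtain ⟨_, u0, u1, u2⟩ := hU
  obtain ⟨_, _, _, _, h | h | h⟩ := hO <;> linarith

/-- After an elementary move of `Δ0 = ABC` to `Δ0' = ABC'` in a Borromean configuration,
`∂Δ1 ∩ ⟨Δ0'⟩ = ∅` and both points of `∂Δ1 ∩ ⟨Δ2⟩` lie outside the tetrahedron `ABCC'`. -/
theorem stmt17 (Δ0 Δ1 Δ2 : Tri)
    (h01 : Disjoint Δ0.outline Δ1.outline)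
    (h12 : Disjoint Δ1.outline Δ2.outline)
    (h20 : Disjoint Δ2.outline Δ0.outline)
    (hcap : (Δ0.hull ∩ Δ1.hull ∩ Δ2.hull).Nonempty)
    (t0 : ∃ P Q : Pt, P ≠ Q ∧ Δ0.outline ∩ Δ1.hull = {P, Q})
    (t1 : ∃ P Q : Pt, P ≠ Q ∧ Δ1.outline ∩ Δ2.hull = {P, Q})
    (t2 : ∃ P Q : Pt, P ≠ Q ∧ Δ2.outline ∩ Δ0.hull = {P, Q})
    (C' : Pt) (hC' : C' ∉ affineSpan ℝ ({Δ0.A, Δ0.B} : Set Pt))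
    (hmove : (convexHull ℝ ({Δ0.A, Δ0.C, C'} : Set Pt) ∪
        convexHull ℝ ({Δ0.B, Δ0.C, C'} : Set Pt)) ∩ (Δ1.outline ∪ Δ2.outline) = ∅)
    (Δ0' : Tri) (hA : Δ0'.A = Δ0.A) (hB : Δ0'.B = Δ0.B) (hC : Δ0'.C = C') :
    Δ1.outline ∩ Δ0'.hull = ∅ ∧
    ∀ x ∈ Δ1.outline ∩ Δ2.hull,
      x ∉ convexHull ℝ ({Δ0.A, Δ0.B, Δ0.C, C'} : Set Pt) := by
  have key : ∀ x ∈ convexHull ℝ ({Δ0.A, Δ0.B, Δ0.C, C'} : Set Pt), x ∉ Δ1.outline := by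
    obtain ⟨f, g0, g1, g2, hh, ho⟩ := chart Δ1
    obtain ⟨P, Q, hPQ, hset⟩ := t0
    have hU : ∀ x, x ∈ Δ0.outline → x ∈ Δ1.hull → InU f g0 g1 g2 x := by
      intro x hx hx1
      obtain ⟨k0, k1, k2, k3⟩ := (hh x).1 hx1
      have hn : x ∉ Δ1.outline := fun h => Set.disjoint_left.1 h01 hx h
      rw [ho] at hn
      refine ⟨k0, lt_of_le_of_ne k1 ?_, lt_of_le_of_ne k2 ?_, lt_of_le_of_ne k3 ?_⟩ <;>
      · intro h; apply hn; exact ⟨k0, k1, k2, k3, by simp [← h]⟩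
    have hO : ∀ x, x ∈ Δ0.outline ↔ IsOut Δ0.A Δ0.B Δ0.C x := fun x => mem_outl _ _ _ _
    have hPm : P ∈ Δ0.outline ∩ Δ1.hull := by rw [hset]; simp
    have hQm : Q ∈ Δ0.outline ∩ Δ1.hull := by rw [hset]; simp
    have inj := Δ0.indep.injective
    have hAB : Δ0.A ≠ Δ0.B := fun h => by
      have := @inj 0 1 (by simpa using h); simp at this
    have hBC : Δ0.B ≠ Δ0.C := fun h => by
      have := @inj 1 2 (by simpa using h); simp at this
    have hCA : Δ0.C ≠ Δ0.A := fun h => by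
      have := @inj 2 0 (by simpa using h); simp at this
    have hPO := (hO P).1 hPm.1
    have hQO := (hO Q).1 hQm.1
    have hPU := hU P hPm.1 hPm.2
    have hQU := hU Q hQm.1 hQm.2
    have H := hull_U f g0 g1 g2 Δ0.A Δ0.B Δ0.C P Q hPQ hAB hBC hCA hPO hQO hPU hQU (by
      intro x hx hxU
      have : x ∈ Δ0.outline ∩ Δ1.hull :=
        ⟨(hO x).2 hx, (hh x).2 ⟨hxU.1, hxU.2.1.le, hxU.2.2.1.le, hxU.2.2.2.le⟩⟩
      rw [hset] at this
      simpa using this)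
    have hPH : IsHull Δ0.A Δ0.B Δ0.C P := by
      obtain ⟨a, b, c, ha, hb, hc, h, _, e⟩ := hPO
      exact ⟨a, b, c, ha, hb, hc, h, e⟩
    intro x hx hx1
    refine main_disj f g0 g1 g2 Δ0.A Δ0.B Δ0.C C' P hPH hPU ?_ ?_ ?_ x hx ((ho x).1 hx1)
    · intro y hy hyO
      obtain ⟨_, u0, u1, u2⟩ := H y hy hyO.1
      obtain ⟨_, _, _, _, h | h | h⟩ := hyO <;> linarith
    · intro y hy hyO
      have : y ∈ (∅ : Set Pt) := by
        rw [← hmove]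
        exact ⟨Or.inl ((mem_hull3 _ _ _ _).2 hy), Or.inl ((ho y).2 hyO)⟩
      exact this
    · intro y hy hyO
      have : y ∈ (∅ : Set Pt) := by
        rw [← hmove]
        exact ⟨Or.inr ((mem_hull3 _ _ _ _).2 hy), Or.inl ((ho y).2 hyO)⟩
      exact this
  constructor
  · rw [Set.eq_empty_iff_forall_notMem]
    rintro x ⟨hx1, hx2⟩
    refine key x (convexHull_mono ?_ hx2) hx1
    rw [hA, hB, hC]
    intro y hy
    simp only [Set.mem_insert_iff, Set.mem_singleton_iff] at hy ⊢
    tauto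
  · rintro x ⟨hx1, _⟩ hx
    exact key x hx hx1
end
end
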